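/- arXiv:2601.16121 — 4 statements merged into one kernel-verified Lean document; each statement's English description precedes it below -/
import Mathlib

section
/- Let N be a positive integer, let X, Y, S be real 2N×2N matrices and δ ∈ ℝ^{2N}. Then G_{I,−S,0} ∘ G_{X,Y,δ} ∘ G_{I,S,0} = G_{X, Y + XSXᵀ − S, δ} as maps on functions ℝ^{2N} → ℂ. In particular, if S satisfies the Stein equation S = XSXᵀ + Y, then G_{I,−S,0} ∘ G_{X,Y,δ} ∘ G_{I,S,0} = G_{X,0,δ}, i.e. the conjugated Gaussian channel action is diffusion-free. -/
open Matrix Complex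

/-- Gaussian channel action on functions of phase-space variables:
`(G X Y δ f)(ξ) = exp(−(1/2)·ξᵀYξ + i·δᵀξ) · f(Xᵀξ)`. -/
noncomputable def GaussAction {N : ℕ} (X Y : Matrix (Fin (2 * N)) (Fin (2 * N)) ℝ)
    (δ : Fin (2 * N) → ℝ) (f : (Fin (2 * N) → ℝ) → ℂ) : (Fin (2 * N) → ℝ) → ℂ :=
  fun ξ => Complex.exp (-(1 / 2 : ℂ) * ((ξ ⬝ᵥ Y.mulVec ξ : ℝ) : ℂ)
      + Complex.I * ((δ ⬝ᵥ ξ : ℝ) : ℂ)) * f (Xᵀ.mulVec ξ)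

/-- Composition law for Gaussian channel actions. -/
theorem GaussAction_comp {N : ℕ} (X₁ Y₁ X₂ Y₂ : Matrix (Fin (2 * N)) (Fin (2 * N)) ℝ)
    (δ₁ δ₂ : Fin (2 * N) → ℝ) :
    GaussAction X₁ Y₁ δ₁ ∘ GaussAction X₂ Y₂ δ₂
      = GaussAction (X₁ * X₂) (Y₁ + X₁ * Y₂ * X₁ᵀ) (δ₁ + X₁ *ᵥ δ₂) := by
  funext f ξ
  have hY : X₁ᵀ *ᵥ ξ ⬝ᵥ Y₂ *ᵥ (X₁ᵀ *ᵥ ξ) = ξ ⬝ᵥ (X₁ * Y₂ * X₁ᵀ) *ᵥ ξ := by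
    rw [← mulVec_mulVec, ← mulVec_mulVec, dotProduct_mulVec ξ X₁, mulVec_transpose]
  have hδ : δ₂ ⬝ᵥ X₁ᵀ *ᵥ ξ = X₁ *ᵥ δ₂ ⬝ᵥ ξ := by
    rw [dotProduct_mulVec, vecMul_transpose]
  simp only [Function.comp_apply, GaussAction, hY, hδ, add_mulVec, dotProduct_add,
    add_dotProduct, transpose_mul]
  rw [← mulVec_mulVec ξ X₂ᵀ, ← mul_assoc, ← Complex.exp_add]
  congr 2
  push_cast
  ring

/-- Stein noise gauging at the level of the Gaussian-channel parametrization: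
`G_{I,−S,0} ∘ G_{X,Y,δ} ∘ G_{I,S,0} = G_{X, Y + XSXᵀ − S, δ}`, and hence if `S = XSXᵀ + Y`
(the Stein equation) the conjugated action is the diffusion-free `G_{X,0,δ}`. -/
theorem stein_noise_gauging (N : ℕ) (hN : 0 < N)
    (X Y S : Matrix (Fin (2 * N)) (Fin (2 * N)) ℝ) (δ : Fin (2 * N) → ℝ) :
    (GaussAction (1 : Matrix (Fin (2 * N)) (Fin (2 * N)) ℝ) (-S) (0 : Fin (2 * N) → ℝ) ∘
        GaussAction X Y δ ∘
        GaussAction (1 : Matrix (Fin (2 * N)) (Fin (2 * N)) ℝ) S (0 : Fin (2 * N) → ℝ)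
      = GaussAction X (Y + X * S * Xᵀ - S) δ)
    ∧ (S = X * S * Xᵀ + Y →
        GaussAction (1 : Matrix (Fin (2 * N)) (Fin (2 * N)) ℝ) (-S) (0 : Fin (2 * N) → ℝ) ∘
          GaussAction X Y δ ∘
          GaussAction (1 : Matrix (Fin (2 * N)) (Fin (2 * N)) ℝ) S (0 : Fin (2 * N) → ℝ)
        = GaussAction X (0 : Matrix (Fin (2 * N)) (Fin (2 * N)) ℝ) δ) := by
  have h : GaussAction (1 : Matrix (Fin (2 * N)) (Fin (2 * N)) ℝ) (-S) (0 : Fin (2 * N) → ℝ) ∘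
        GaussAction X Y δ ∘
        GaussAction (1 : Matrix (Fin (2 * N)) (Fin (2 * N)) ℝ) S (0 : Fin (2 * N) → ℝ)
      = GaussAction X (Y + X * S * Xᵀ - S) δ := by
    simp only [GaussAction_comp, one_mul, mul_one, transpose_one, mulVec_zero, one_mulVec,
      add_zero, zero_add, neg_add_eq_sub]
  refine ⟨h, fun hS => ?_⟩
  rw [h, add_comm Y, ← hS, sub_self]
end

section
/- Let n be a positive integer and let A be a real n×n Hurwitz matrix, i.e. every complex eigenvalue of A has strictly negative real part. If a real n×n matrix S satisfies A S + S Aᵀ = 0, then S = 0. Consequently, for any real n×n matrix D, the Lyapunov equation A S + S Aᵀ + D = 0 has at most one solution S. -/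
open Matrix

/-- A real square matrix is Hurwitz if every complex eigenvalue has strictly negative real part. -/
def IsHurwitz {n : ℕ} (A : Matrix (Fin n) (Fin n) ℝ) : Prop :=
  ∀ μ ∈ spectrum ℂ (A.map (fun x => (x : ℂ))), μ.re < 0

section

variable {R m n : Type*} [CommRing R] [Fintype m] [DecidableEq m] [Fintype n] [DecidableEq n]

/-- A matrix intertwining `A` and `B` intertwines `p(A)` and `p(B)` for every polynomial `p`. -/
theorem Matrix.aeval_mul_eq_mul_aeval {A : Matrix m m R} {B : Matrix n n R} {S : Matrix m n R}
    (h : A * S = S * B) (p : Polynomial R) :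
    Polynomial.aeval A p * S = S * Polynomial.aeval B p := by
  induction p using Polynomial.induction_on' with
  | add p q hp hq => simp [Matrix.add_mul, Matrix.mul_add, hp, hq]
  | monomial k a =>
    have hk : A ^ k * S = S * B ^ k := by
      induction k with
      | zero => simp
      | succ k ih => rw [pow_succ, pow_succ, Matrix.mul_assoc, h, ← Matrix.mul_assoc, ih,
          Matrix.mul_assoc]
    simp [Polynomial.aeval_monomial, Algebra.algebraMap_eq_smul_one, hk]

end

/-- Sylvester's theorem: over an algebraically closed field, only the zero matrix intertwines
two matrices with disjoint spectra. -/
theorem Matrix.eq_zero_of_mul_eq_mul_of_disjoint_spectrum {K m n : Type*} [Field K] [IsAlgClosed K]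
    [Fintype m] [DecidableEq m] [Fintype n] [DecidableEq n]
    {A : Matrix m m K} {B : Matrix n n K} {S : Matrix m n K}
    (hAB : Disjoint (spectrum K A) (spectrum K B)) (h : A * S = S * B) : S = 0 := by
  have hS := Matrix.aeval_mul_eq_mul_aeval h B.charpoly
  rw [Matrix.aeval_self_charpoly, Matrix.mul_zero] at hS
  cases isEmpty_or_nonempty m with
  | inl _ => exact Subsingleton.elim _ _
  | inr _ =>
    have hu : IsUnit (Polynomial.aeval A B.charpoly) := by
      rw [← spectrum.zero_notMem_iff K, spectrum.map_polynomial_aeval_of_nonempty _ _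
        (spectrum.nonempty_of_isAlgClosed_of_finiteDimensional K A)]
      rintro ⟨k, hkA, hkB⟩
      exact Set.disjoint_left.1 hAB hkA (Matrix.mem_spectrum_iff_isRoot_charpoly.2 hkB)
    rw [← Matrix.nonsing_inv_mul_cancel_left (A := Polynomial.aeval A B.charpoly) S
      ((Matrix.isUnit_iff_isUnit_det _).1 hu), hS, Matrix.mul_zero]

/-- A square matrix and its transpose have the same spectrum. -/
theorem Matrix.spectrum_transpose {K n : Type*} [Field K] [Fintype n] [DecidableEq n]
    (A : Matrix n n K) : spectrum K Aᵀ = spectrum K A := by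
  ext k
  rw [Matrix.mem_spectrum_iff_isRoot_charpoly, Matrix.mem_spectrum_iff_isRoot_charpoly,
    Matrix.charpoly_transpose]

/-- The homogeneous Lyapunov equation of a Hurwitz matrix has only the zero solution. -/
theorem IsHurwitz.eq_zero_of_mul_add_mul_transpose_eq_zero {n : ℕ}
    {A S : Matrix (Fin n) (Fin n) ℝ} (hA : IsHurwitz A) (h : A * S + S * Aᵀ = 0) : S = 0 := by
  have hmap : A.map Complex.ofRealHom * S.map Complex.ofRealHom =
      S.map Complex.ofRealHom * -(A.map Complex.ofRealHom)ᵀ := by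
    rw [Matrix.mul_neg, ← Matrix.transpose_map, ← Matrix.map_mul, ← Matrix.map_mul,
      eq_neg_of_add_eq_zero_left h]
    ext i j
    simp only [Matrix.map_apply, Matrix.neg_apply, map_neg]
  have hdisj : Disjoint (spectrum ℂ (A.map Complex.ofRealHom))
      (spectrum ℂ (-(A.map Complex.ofRealHom)ᵀ)) := by
    rw [Set.disjoint_left]
    intro μ hμ hμ'
    rw [← spectrum.neg_eq, Set.mem_neg, Matrix.spectrum_transpose] at hμ'
    have h₁ : μ.re < 0 := hA μ hμ
    have h₂ : (-μ).re < 0 := hA (-μ) hμ'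
    rw [Complex.neg_re] at h₂
    linarith
  have hS := Matrix.eq_zero_of_mul_eq_mul_of_disjoint_spectrum hdisj hmap
  ext i j
  simpa using congrFun (congrFun hS i) j

/-- For Hurwitz `A`, the homogeneous Lyapunov equation `AS + SAᵀ = 0` forces `S = 0`;
consequently the Lyapunov equation `AS + SAᵀ + D = 0` has at most one solution. -/
theorem lyapunov_uniqueness (n : ℕ) (hn : 0 < n)
    (A : Matrix (Fin n) (Fin n) ℝ) (hA : IsHurwitz A) :
    (∀ S : Matrix (Fin n) (Fin n) ℝ, A * S + S * Aᵀ = 0 → S = 0)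
    ∧ (∀ (D S₁ S₂ : Matrix (Fin n) (Fin n) ℝ),
        A * S₁ + S₁ * Aᵀ + D = 0 → A * S₂ + S₂ * Aᵀ + D = 0 → S₁ = S₂) := by
  refine ⟨fun S => hA.eq_zero_of_mul_add_mul_transpose_eq_zero, fun D S₁ S₂ h₁ h₂ => ?_⟩
  refine sub_eq_zero.1 (hA.eq_zero_of_mul_add_mul_transpose_eq_zero ?_)
  rw [Matrix.mul_sub, Matrix.sub_mul, sub_add_sub_comm, sub_eq_zero]
  exact add_right_cancel (h₁.trans h₂.symm)
end

section
/- Let Y be a real symmetric 2×2 matrix and let α ∈ ℝ. Let Σ denote the real 2×2 matrix with rows (0, 1) and (−1, 0), and consider the complex Hermitian 2×2 matrix Z = Y + i·α·Σ (entrywise, with Y and Σ embedded into ℂ). Then Z is positive semidefinite if and only if Y is positive semidefinite and det Y ≥ α². In particular, for a single bosonic mode the complete-positivity condition Y + (i/2)(Σ − XΣXᵀ) ⪰ 0 of a Gaussian channel (X, Y) reduces, using XΣXᵀ = (det X)Σ, to the scalar conditions Y ⪰ 0 and det Y ≥ ((1 − det X)/2)². -/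
open Matrix
open scoped ComplexOrder

/-- A `2×2` Hermitian matrix is positive semidefinite iff its trace and determinant are
nonnegative. -/
theorem Matrix.IsHermitian.posSemidef_fin_two_iff {𝕜 : Type*} [RCLike 𝕜]
    {M : Matrix (Fin 2) (Fin 2) 𝕜} (hM : M.IsHermitian) :
    M.PosSemidef ↔ 0 ≤ M.trace ∧ 0 ≤ M.det := by
  refine ⟨fun h => ⟨h.trace_nonneg, h.det_nonneg⟩, fun ⟨htr, hdet⟩ => ?_⟩
  rw [hM.trace_eq_sum_eigenvalues, Fin.sum_univ_two] at htr
  rw [hM.det_eq_prod_eigenvalues, Fin.prod_univ_two] at hdet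
  norm_cast at htr hdet
  rw [hM.posSemidef_iff_eigenvalues_nonneg, Pi.le_def, Fin.forall_fin_two]
  simp only [Pi.zero_apply]
  constructor <;> by_contra! hneg <;> nlinarith

/-- For real symmetric `Y`, the Hermitian matrix `Y + iαΣ` is positive semidefinite iff `Y` is
positive semidefinite and `det Y ≥ α²`. -/
theorem posSemidef_add_I_smul_symplectic_iff {Y : Matrix (Fin 2) (Fin 2) ℝ} (hY : Yᵀ = Y)
    (α : ℝ) :
    (Y.map (fun x => (x : ℂ))
        + (Complex.I * (α : ℂ)) • (!![(0 : ℝ), 1; -1, 0]).map (fun x => (x : ℂ))).PosSemidef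
      ↔ Y.PosSemidef ∧ α ^ 2 ≤ Y.det := by
  have hoff : Y 1 0 = Y 0 1 := congrFun (congrFun hY 0) 1
  have hYH : Y.IsHermitian := by rw [IsHermitian, conjTranspose_eq_transpose_of_trivial, hY]
  set Z := Y.map (fun x => (x : ℂ))
    + (Complex.I * (α : ℂ)) • (!![(0 : ℝ), 1; -1, 0]).map (fun x => (x : ℂ)) with hZ
  have hZH : Z.IsHermitian := by
    ext i j
    fin_cases i <;> fin_cases j <;> simp [hZ, hoff]
  have htr : Z.trace = (Y.trace : ℂ) := by simp [hZ, trace_fin_two]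
  have hdet : Z.det = ((Y.det - α ^ 2 : ℝ) : ℂ) := by
    simp [hZ, det_fin_two, hoff]
    linear_combination (α : ℂ) ^ 2 * Complex.I_sq
  rw [hZH.posSemidef_fin_two_iff, hYH.posSemidef_fin_two_iff, htr, hdet,
    Complex.zero_le_real, Complex.zero_le_real, sub_nonneg, and_assoc]
  exact and_congr_right fun _ =>
    ⟨fun h => ⟨(sq_nonneg α).trans h, h⟩, fun h => h.2⟩

/-- The symplectic form scales by the determinant under congruence: `XΣXᵀ = (det X)Σ`. -/
theorem mul_symplectic_mul_transpose (X : Matrix (Fin 2) (Fin 2) ℝ) :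
    X * !![(0 : ℝ), 1; -1, 0] * Xᵀ = X.det • !![(0 : ℝ), 1; -1, 0] := by
  ext i j
  fin_cases i <;> fin_cases j <;> simp [mul_apply, Fin.sum_univ_two, det_fin_two] <;> ring

/-- For a real symmetric `2×2` matrix `Y` and `α ∈ ℝ`, the Hermitian matrix `Z = Y + iαΣ`
(`Σ = [[0,1],[−1,0]]`) is positive semidefinite iff `Y` is positive semidefinite and
`det Y ≥ α²`. In particular, the single-mode complete-positivity condition
`Y + (i/2)(Σ − XΣXᵀ) ⪰ 0` reduces to `Y ⪰ 0` and `det Y ≥ ((1 − det X)/2)²`. -/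
theorem single_mode_CP_det (Y : Matrix (Fin 2) (Fin 2) ℝ) (hY : Yᵀ = Y) (α : ℝ) :
    ((Y.map (fun x => (x : ℂ))
        + (Complex.I * (α : ℂ)) • (!![(0 : ℝ), 1; -1, 0]).map (fun x => (x : ℂ))).PosSemidef
      ↔ Y.PosSemidef ∧ α ^ 2 ≤ Y.det)
    ∧ (∀ X : Matrix (Fin 2) (Fin 2) ℝ,
        (Y.map (fun x => (x : ℂ))
            + (Complex.I / 2) •
              ((!![(0 : ℝ), 1; -1, 0] - X * !![(0 : ℝ), 1; -1, 0] * Xᵀ).map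
                (fun x => (x : ℂ)))).PosSemidef
          ↔ Y.PosSemidef ∧ ((1 - X.det) / 2) ^ 2 ≤ Y.det) := by
  refine ⟨posSemidef_add_I_smul_symplectic_iff hY α, fun X => ?_⟩
  rw [← posSemidef_add_I_smul_symplectic_iff hY, mul_symplectic_mul_transpose]
  congr! 2
  ext i j
  fin_cases i <;> fin_cases j <;> simp <;> ring
end

section
/- Let κ, Δ, ε ∈ ℝ and let A be the complex 2×2 matrix with rows (−κ/2, Δ − ε) and (−(Δ + ε), −κ/2). Then A is diagonalizable—i.e. there exist an invertible complex 2×2 matrix P and a function d : Fin 2 → ℂ such that A = P · diag(d) · P⁻¹—if and only if it is NOT the case that (Δ² = ε² and ε ≠ 0). In other words, the squeezed-reservoir drift matrix is defective exactly on the exceptional-point manifold Δ² = ε² with ε ≠ 0. -/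
open Matrix

/-- A matrix is conjugate to `diagonal d` by `P` iff the columns of `P` are eigenvectors. -/
theorem eq_conj_diagonal_iff {n K : Type*} [Fintype n] [DecidableEq n] [CommRing K]
    {A P : Matrix n n K} (d : n → K) (hP : IsUnit P.det) :
    A = P * diagonal d * P⁻¹ ↔ A * P = P * diagonal d := by
  constructor
  · intro h
    rw [h, Matrix.mul_assoc, nonsing_inv_mul P hP, Matrix.mul_one]
  · intro h
    rw [← h, Matrix.mul_assoc, mul_nonsing_inv P hP, Matrix.mul_one]

/-- A complex `2 × 2` matrix with constant diagonal is diagonalizable iff its off-diagonal entries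
are both nonzero or both zero. -/
theorem diagonalizable_constant_diagonal_iff (a b c : ℂ) :
    (∃ (P : Matrix (Fin 2) (Fin 2) ℂ) (d : Fin 2 → ℂ),
        IsUnit P.det ∧ !![a, b; c, a] = P * diagonal d * P⁻¹)
      ↔ (b * c = 0 → b = 0 ∧ c = 0) := by
  constructor
  · rintro ⟨P, d, hP, h⟩ hbc
    rw [eq_conj_diagonal_iff d hP] at h
    have hdet := hP.ne_zero
    rw [det_fin_two] at hdet
    have h00 := congrFun (congrFun h 0) 0
    have h01 := congrFun (congrFun h 0) 1
    have h10 := congrFun (congrFun h 1) 0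
    have h11 := congrFun (congrFun h 1) 1
    simp [Matrix.mul_apply, Fin.sum_univ_two] at h00 h01 h10 h11
    have hd0 : d 0 = a := by
      by_contra hne
      have hs : (d 0 - a) ^ 2 ≠ 0 := pow_ne_zero 2 (sub_ne_zero.mpr hne)
      have hp : P 0 0 = 0 := (mul_eq_zero.mp (by grind : (d 0 - a) ^ 2 * P 0 0 = 0)).resolve_left hs
      have hq : P 1 0 = 0 := (mul_eq_zero.mp (by grind : (d 0 - a) ^ 2 * P 1 0 = 0)).resolve_left hs
      simp [hp, hq] at hdet
    have hd1 : d 1 = a := by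
      by_contra hne
      have hs : (d 1 - a) ^ 2 ≠ 0 := pow_ne_zero 2 (sub_ne_zero.mpr hne)
      have hp : P 0 1 = 0 := (mul_eq_zero.mp (by grind : (d 1 - a) ^ 2 * P 0 1 = 0)).resolve_left hs
      have hq : P 1 1 = 0 := (mul_eq_zero.mp (by grind : (d 1 - a) ^ 2 * P 1 1 = 0)).resolve_left hs
      simp [hp, hq] at hdet
    rw [hd0] at h00 h10
    rw [hd1] at h01 h11
    constructor
    · refine (mul_eq_zero.mp ?_).resolve_right hdet
      linear_combination P 0 0 * h01 - P 0 1 * h00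
    · refine (mul_eq_zero.mp ?_).resolve_right hdet
      linear_combination P 1 1 * h10 - P 1 0 * h11
  · intro h
    by_cases hbc : b * c = 0
    · obtain ⟨rfl, rfl⟩ := h hbc
      refine ⟨1, fun _ => a, by simp, ?_⟩
      ext i j
      fin_cases i <;> fin_cases j <;> simp
    · obtain ⟨s, hs⟩ := IsAlgClosed.exists_eq_mul_self (b * c)
      have hb : b ≠ 0 := left_ne_zero_of_mul hbc
      have hs0 : s ≠ 0 := by
        rintro rfl
        simp [hs] at hbc
      have hP : IsUnit (!![b, b; s, -s] : Matrix (Fin 2) (Fin 2) ℂ).det := by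
        rw [isUnit_iff_ne_zero, det_fin_two_of,
          show b * -s - b * s = -2 * (b * s) by ring]
        exact mul_ne_zero (by norm_num) (mul_ne_zero hb hs0)
      refine ⟨!![b, b; s, -s], ![a + s, a - s], hP, ?_⟩
      rw [eq_conj_diagonal_iff _ hP]
      ext i j
      fin_cases i <;> fin_cases j <;> simp [Matrix.mul_apply, Fin.sum_univ_two] <;> grind

/-- The squeezed-reservoir drift matrix `A = [[−κ/2, Δ−ε],[−(Δ+ε), −κ/2]]` is diagonalizable
over ℂ iff it is not the case that `Δ² = ε²` with `ε ≠ 0`; i.e. it is defective exactly on the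
exceptional-point manifold `Δ² = ε²`, `ε ≠ 0`. -/
theorem squeezed_reservoir_EP (κ Δ ε : ℝ) :
    (∃ (P : Matrix (Fin 2) (Fin 2) ℂ) (d : Fin 2 → ℂ),
        IsUnit P.det ∧
          !![(-(κ : ℂ) / 2), ((Δ : ℂ) - (ε : ℂ)); (-((Δ : ℂ) + (ε : ℂ))), (-(κ : ℂ) / 2)]
            = P * Matrix.diagonal d * P⁻¹)
      ↔ ¬(Δ ^ 2 = ε ^ 2 ∧ ε ≠ 0) := by
  rw [diagonalizable_constant_diagonal_iff]
  norm_cast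
  grind
end
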